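/- arXiv:math/0310465 — 9 statements merged into one kernel-verified Lean document; each statement's English description precedes it below -/
import Mathlib

section
/- Let U ⊆ ℂ be an open set and let P, Q : U → ℂ be holomorphic. If y₁ and y₂ are holomorphic functions on U each satisfying the second-order equation y'' + P·y' + Q·y = 0 on U, then their product Ψ = y₁·y₂ satisfies the third-order equation Ψ''' + 3P·Ψ'' + (P' + 4Q + 2P²)·Ψ' + (2Q' + 4P·Q)·Ψ = 0 on U. -/
/-- If `y₁`, `y₂` are holomorphic solutions on an open set `U ⊆ ℂ` of the second-order
equation `y'' + P·y' + Q·y = 0` with holomorphic coefficients `P`, `Q`, then their product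
`Ψ = y₁·y₂` satisfies `Ψ''' + 3P·Ψ'' + (P' + 4Q + 2P²)·Ψ' + (2Q' + 4P·Q)·Ψ = 0` on `U`. -/
theorem product_of_solutions_satisfies_third_order
    (U : Set ℂ) (hU : IsOpen U) (P Q y₁ y₂ : ℂ → ℂ)
    (hP : DifferentiableOn ℂ P U) (hQ : DifferentiableOn ℂ Q U)
    (hy₁ : DifferentiableOn ℂ y₁ U) (hy₁' : DifferentiableOn ℂ (deriv y₁) U)
    (hy₂ : DifferentiableOn ℂ y₂ U) (hy₂' : DifferentiableOn ℂ (deriv y₂) U)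
    (heq₁ : ∀ z ∈ U, deriv (deriv y₁) z + P z * deriv y₁ z + Q z * y₁ z = 0)
    (heq₂ : ∀ z ∈ U, deriv (deriv y₂) z + P z * deriv y₂ z + Q z * y₂ z = 0) :
    ∀ z ∈ U,
      deriv (deriv (deriv (fun t => y₁ t * y₂ t))) z
        + 3 * P z * deriv (deriv (fun t => y₁ t * y₂ t)) z
        + (deriv P z + 4 * Q z + 2 * (P z) ^ 2) * deriv (fun t => y₁ t * y₂ t) z
        + (2 * deriv Q z + 4 * P z * Q z) * (y₁ z * y₂ z) = 0 := by
  have hd : ∀ {f : ℂ → ℂ}, DifferentiableOn ℂ f U → ∀ z ∈ U, HasDerivAt f (deriv f z) z :=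
    fun hf z hz => (hf.differentiableAt (hU.mem_nhds hz)).hasDerivAt
  have h₁ : ∀ z ∈ U, deriv (fun t => y₁ t * y₂ t) z
      = deriv y₁ z * y₂ z + y₁ z * deriv y₂ z :=
    fun z hz => ((hd hy₁ z hz).mul (hd hy₂ z hz)).deriv
  have h₂ : ∀ z ∈ U, deriv (deriv (fun t => y₁ t * y₂ t)) z
      = 2 * (deriv y₁ z * deriv y₂ z) - P z * (deriv y₁ z * y₂ z + y₁ z * deriv y₂ z)
        - 2 * (Q z * (y₁ z * y₂ z)) := by
    intro z hz
    rw [(Filter.eventuallyEq_of_mem (hU.mem_nhds hz) h₁).deriv_eq]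
    refine (((hd hy₁' z hz).mul (hd hy₂ z hz)).add
      ((hd hy₁ z hz).mul (hd hy₂' z hz))).deriv.trans ?_
    linear_combination y₂ z * heq₁ z hz + y₁ z * heq₂ z hz
  intro z hz
  have h₃ := (Filter.eventuallyEq_of_mem (hU.mem_nhds hz) h₂).deriv_eq.trans
    (((((hd hy₁' z hz).mul (hd hy₂' z hz)).const_mul 2).sub
      ((hd hP z hz).mul (((hd hy₁' z hz).mul (hd hy₂ z hz)).add
        ((hd hy₁ z hz).mul (hd hy₂' z hz))))).sub
      (((hd hQ z hz).mul ((hd hy₁ z hz).mul (hd hy₂ z hz))).const_mul 2)).deriv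
  rw [h₃, h₂ z hz, h₁ z hz]
  simp only [Pi.mul_apply, Pi.add_apply]
  linear_combination (2 * deriv y₂ z - P z * y₂ z) * heq₁ z hz
    + (2 * deriv y₁ z - P z * y₁ z) * heq₂ z hz
end

section
/- Let U ⊆ ℂ be an open set and let P, Q : U → ℂ be holomorphic. If y₁ and y₂ are holomorphic solutions on U of y'' + P·y' + Q·y = 0, then, writing Ψ = y₁·y₂ and W = y₁·y₂' − y₂·y₁', one has the identity W² = (Ψ')² − 2·Ψ·Ψ'' − 2P·Ψ·Ψ' − 4Q·Ψ² at every point of U. -/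
/-- If `y₁`, `y₂` are holomorphic solutions on an open set `U ⊆ ℂ` of `y'' + P·y' + Q·y = 0`,
then, with `Ψ = y₁·y₂` and `W = y₁·y₂' − y₂·y₁'`, one has
`W² = (Ψ')² − 2·Ψ·Ψ'' − 2P·Ψ·Ψ' − 4Q·Ψ²` at every point of `U`. -/
theorem wronskian_squared_identity
    (U : Set ℂ) (hU : IsOpen U) (P Q y₁ y₂ : ℂ → ℂ)
    (hP : DifferentiableOn ℂ P U) (hQ : DifferentiableOn ℂ Q U)
    (hy₁ : DifferentiableOn ℂ y₁ U) (hy₁' : DifferentiableOn ℂ (deriv y₁) U)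
    (hy₂ : DifferentiableOn ℂ y₂ U) (hy₂' : DifferentiableOn ℂ (deriv y₂) U)
    (heq₁ : ∀ z ∈ U, deriv (deriv y₁) z + P z * deriv y₁ z + Q z * y₁ z = 0)
    (heq₂ : ∀ z ∈ U, deriv (deriv y₂) z + P z * deriv y₂ z + Q z * y₂ z = 0) :
    ∀ z ∈ U,
      (y₁ z * deriv y₂ z - y₂ z * deriv y₁ z) ^ 2
        = (deriv (fun t => y₁ t * y₂ t) z) ^ 2
          - 2 * (y₁ z * y₂ z) * deriv (deriv (fun t => y₁ t * y₂ t)) z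
          - 2 * P z * (y₁ z * y₂ z) * deriv (fun t => y₁ t * y₂ t) z
          - 4 * Q z * (y₁ z * y₂ z) ^ 2 := by
  have hderiv : ∀ z ∈ U, deriv (fun t => y₁ t * y₂ t) z
      = deriv y₁ z * y₂ z + y₁ z * deriv y₂ z := fun z hz =>
    ((hy₁.differentiableAt (hU.mem_nhds hz)).hasDerivAt.mul
      (hy₂.differentiableAt (hU.mem_nhds hz)).hasDerivAt).deriv
  intro z hz
  have hU_nhds := hU.mem_nhds hz
  have h₁ := (hy₁.differentiableAt hU_nhds).hasDerivAt
  have h₂ := (hy₂.differentiableAt hU_nhds).hasDerivAt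
  have h₁' := (hy₁'.differentiableAt hU_nhds).hasDerivAt
  have h₂' := (hy₂'.differentiableAt hU_nhds).hasDerivAt
  have hderiv2 : deriv (deriv (fun t => y₁ t * y₂ t)) z
      = (deriv (deriv y₁) z * y₂ z + deriv y₁ z * deriv y₂ z)
        + (deriv y₁ z * deriv y₂ z + y₁ z * deriv (deriv y₂) z) :=
    (((h₁'.mul h₂).add (h₁.mul h₂')).congr_of_eventuallyEq
      (Filter.eventually_of_mem hU_nhds hderiv)).deriv
  rw [hderiv2, hderiv z hz]
  linear_combination 2 * (y₁ z * y₂ z) * y₂ z * heq₁ z hz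
    + 2 * (y₁ z * y₂ z) * y₁ z * heq₂ z hz
end

section
/- Let U ⊆ ℂ be an open set, let P, Q : U → ℂ be holomorphic, and let Ψ, w, S, F : U → ℂ be holomorphic functions such that S is nonvanishing on U, S² = Ψ, w' = −P·w, w² = (Ψ')² − 2·Ψ·Ψ'' − 2P·Ψ·Ψ' − 4Q·Ψ², and F' = −w/(2Ψ) on U. Then the function Y := S·exp(F) satisfies the second-order equation Y'' + P·Y' + Q·Y = 0 on U. (This justifies the closed-form expression Y = √Ψ · exp(±(i ν/2)∫ dz / (Ψ·(Wronskian weight)) for the finite-gap solutions of the Fuchsian equation.) -/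
/-- Let `P`, `Q`, `Ψ`, `w`, `S`, `F` be holomorphic on an open set `U ⊆ ℂ` with `S`
nonvanishing, `S² = Ψ`, `w' = −P·w`, `w² = (Ψ')² − 2·Ψ·Ψ'' − 2P·Ψ·Ψ' − 4Q·Ψ²` and
`F' = −w/(2Ψ)` on `U`. Then `Y := S·exp(F)` satisfies `Y'' + P·Y' + Q·Y = 0` on `U`. -/
theorem finite_gap_closed_form_solves_second_order
    (U : Set ℂ) (hU : IsOpen U) (P Q Ψ w S F : ℂ → ℂ)
    (hP : DifferentiableOn ℂ P U) (hQ : DifferentiableOn ℂ Q U)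
    (hΨ : DifferentiableOn ℂ Ψ U) (hΨ' : DifferentiableOn ℂ (deriv Ψ) U)
    (hw : DifferentiableOn ℂ w U) (hS : DifferentiableOn ℂ S U)
    (hF : DifferentiableOn ℂ F U)
    (hSne : ∀ z ∈ U, S z ≠ 0)
    (hS2 : ∀ z ∈ U, (S z) ^ 2 = Ψ z)
    (hw' : ∀ z ∈ U, deriv w z = -P z * w z)
    (hw2 : ∀ z ∈ U,
      (w z) ^ 2 = (deriv Ψ z) ^ 2 - 2 * Ψ z * deriv (deriv Ψ) z
        - 2 * P z * Ψ z * deriv Ψ z - 4 * Q z * (Ψ z) ^ 2)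
    (hF' : ∀ z ∈ U, deriv F z = -w z / (2 * Ψ z)) :
    ∀ z ∈ U,
      deriv (deriv (fun t => S t * Complex.exp (F t))) z
        + P z * deriv (fun t => S t * Complex.exp (F t)) z
        + Q z * (S z * Complex.exp (F z)) = 0 := by
  set Y : ℂ → ℂ := fun t => S t * Complex.exp (F t) with hY
  have hasDerivAt_of {f : ℂ → ℂ} (hf : DifferentiableOn ℂ f U) {z : ℂ} (hz : z ∈ U) :
      HasDerivAt f (deriv f z) z :=
    (hf.differentiableAt (hU.mem_nhds hz)).hasDerivAt
  have hΨne : ∀ z ∈ U, Ψ z ≠ 0 := fun z hz => hS2 z hz ▸ pow_ne_zero 2 (hSne z hz)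
  have hdΨ : ∀ z ∈ U, deriv Ψ z = 2 * S z * deriv S z := by
    intro z hz
    have heq : Ψ =ᶠ[nhds z] fun t => S t ^ 2 :=
      Filter.mem_of_superset (hU.mem_nhds hz) fun t ht => (hS2 t ht).symm
    rw [heq.deriv_eq, ((hasDerivAt_of hS hz).fun_pow 2).deriv]
    norm_num
  have hYd : ∀ z ∈ U, HasDerivAt Y ((deriv Ψ z - w z) / (2 * Ψ z) * Y z) z := by
    intro z hz
    refine ((hasDerivAt_of hS hz).mul (hasDerivAt_of hF hz).cexp).congr_deriv ?_
    have hne := hSne z hz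
    rw [hF' z hz, hdΨ z hz, ← hS2 z hz]
    simp only [hY]
    field_simp
    ring
  intro z hz
  have hne := hΨne z hz
  have heq : deriv Y =ᶠ[nhds z] fun t => (deriv Ψ t - w t) / (2 * Ψ t) * Y t :=
    Filter.mem_of_superset (hU.mem_nhds hz) fun t ht => (hYd t ht).deriv
  have hYdd := (((hasDerivAt_of hΨ' hz).fun_sub (hasDerivAt_of hw hz)).fun_div
    ((hasDerivAt_of hΨ hz).const_mul 2) (mul_ne_zero two_ne_zero hne)).fun_mul (hYd z hz)
  rw [heq.deriv_eq, hYdd.deriv, (hYd z hz).deriv, hw' z hz]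
  change _ + _ + Q z * Y z = 0
  field_simp
  linear_combination Y z * hw2 z hz
end

section
/- Take characteristics (m₀, m₁, m₂, m₃) = (0,0,0,0) (so N = 2, ρ = 3b² − 2(a+1)b + a) and assume b² = a. Then for every λ ∈ ℂ the function Ψ(λ, z) = (z−b)²λ + (3+3a−4b)z² − 2(5b+5ab−8a)z + a(3+3a−4b) satisfies the third-order equation Ψ''' + 3P·Ψ'' + (P' + 4Q + 2P²)·Ψ' + (2Q' + 4P·Q)·Ψ = 0 at every z ∈ ℂ ∖ {0, 1, a, b} (derivatives in z). -/
/-- Coefficient `P(z)` of the five-singular-point Fuchsian equation with singular points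
`0, 1, a, b, ∞` and characteristics `(m₀, m₁, m₂, m₃; n₁ = 1)`. -/
noncomputable def Pcoef (m₁ m₂ m₃ : ℕ) (a b z : ℂ) : ℂ :=
  (1/2) * ((1 - 2*(m₁:ℂ))/z + (1 - 2*(m₂:ℂ))/(z-1) + (1 - 2*(m₃:ℂ))/(z-a)) - 2/(z-b)

/-- Coefficient `Q(z)` of the five-singular-point Fuchsian equation, with
`N = m₀ + m₁ + m₂ + m₃ + 2` and
`ρ = 2(b−1)(b−a)m₁ + 2b(b−a)m₂ + 2b(b−1)m₃ + 3b² − 2(a+1)b + a`. -/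
noncomputable def Qcoef (m₀ m₁ m₂ m₃ : ℕ) (a b lam z : ℂ) : ℂ :=
  (((m₀:ℂ) + (m₁:ℂ) + (m₂:ℂ) + (m₃:ℂ) + 2)
      * (((m₀:ℂ) + (m₁:ℂ) + (m₂:ℂ) + (m₃:ℂ) + 2) - 2*(m₀:ℂ) - 1) * z
    + lam
    + 2*(2*(b-1)*(b-a)*(m₁:ℂ) + 2*b*(b-a)*(m₂:ℂ) + 2*b*(b-1)*(m₃:ℂ)
          + 3*b^2 - 2*(a+1)*b + a) / (z-b))
  / (4*z*(z-1)*(z-a))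

/-- The third-order equation `Ψ''' + 3P·Ψ'' + (P' + 4Q + 2P²)·Ψ' + (2Q' + 4P·Q)·Ψ = 0`
satisfied by products of pairs of solutions of `y'' + P·y' + Q·y = 0`. -/
def ThirdOrderODE (P Q Ψ : ℂ → ℂ) (z : ℂ) : Prop :=
  deriv (deriv (deriv Ψ)) z + 3 * P z * deriv (deriv Ψ) z
    + (deriv P z + 4 * Q z + 2 * (P z)^2) * deriv Ψ z
    + (2 * deriv Q z + 4 * P z * Q z) * Ψ z = 0

theorem hasDerivAt_Pcoef_zero {a b z : ℂ} (h0 : z ≠ 0) (h1 : z ≠ 1) (ha : z ≠ a) (hb : z ≠ b) :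
    HasDerivAt (Pcoef 0 0 0 a b)
      (-(1/2) * (1/z^2 + 1/(z-1)^2 + 1/(z-a)^2) + 2/(z-b)^2) z := by
  have key (c k : ℂ) (hc : z ≠ c) : HasDerivAt (fun t => k / (t - c)) (-k / (z - c)^2) z := by
    simpa using (hasDerivAt_const z k).fun_div ((hasDerivAt_id' z).sub_const c) (sub_ne_zero.2 hc)
  have h := ((((key 0 1 h0).fun_add (key 1 1 h1)).fun_add (key a 1 ha)).const_mul (1/2)).fun_sub
    (key b 2 hb)
  refine (h.congr_deriv (by ring)).congr_of_eventuallyEq (.of_forall fun t => ?_)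
  simp [Pcoef]

theorem hasDerivAt_Qcoef_zero {a b z : ℂ} (lam : ℂ) (h0 : z ≠ 0) (h1 : z ≠ 1) (ha : z ≠ a)
    (hb : z ≠ b) :
    HasDerivAt (Qcoef 0 0 0 0 a b lam)
      (((2 - 2*(3*b^2 - 2*(a+1)*b + a)/(z-b)^2) * (4*z*(z-1)*(z-a))
        - (2*z + lam + 2*(3*b^2 - 2*(a+1)*b + a)/(z-b))
          * (4*((z-1)*(z-a) + z*(z-a) + z*(z-1)))) / (4*z*(z-1)*(z-a))^2) z := by
  have hnum : HasDerivAt (fun t => 2*t + lam + 2*(3*b^2 - 2*(a+1)*b + a)/(t-b))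
      (2 - 2*(3*b^2 - 2*(a+1)*b + a)/(z-b)^2) z := by
    exact ((((hasDerivAt_id' z).const_mul 2).add_const lam).fun_add
      ((hasDerivAt_const z (2*(3*b^2 - 2*(a+1)*b + a))).fun_div
        ((hasDerivAt_id' z).sub_const b) (sub_ne_zero.2 hb))).congr_deriv (by ring)
  have hden : HasDerivAt (fun t => 4*t*(t-1)*(t-a))
      (4*((z-1)*(z-a) + z*(z-a) + z*(z-1))) z := by
    exact ((((hasDerivAt_id' z).const_mul 4).fun_mul ((hasDerivAt_id' z).sub_const 1)).fun_mul
      ((hasDerivAt_id' z).sub_const a)).congr_deriv (by ring)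
  have hne : 4*z*(z-1)*(z-a) ≠ 0 := by
    simp [h0, sub_ne_zero.2 h1, sub_ne_zero.2 ha]
  refine (hnum.fun_div hden hne).congr_of_eventuallyEq (.of_forall fun t => ?_)
  simp only [Qcoef, Nat.cast_zero]
  ring

theorem deriv_quadratic (A B C : ℂ) :
    deriv (fun t : ℂ => A * t^2 + B * t + C) = fun t => 2 * A * t + B := by
  funext t
  have h := (((hasDerivAt_pow 2 t).const_mul A).fun_add
    ((hasDerivAt_id' t).const_mul B)).add_const C
  rw [h.deriv]
  norm_num
  ring

theorem deriv_linear (A B : ℂ) : deriv (fun t : ℂ => A * t + B) = fun _ => A := by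
  funext t
  simp

theorem fuchsian_psi_0000_b2_eq_a (a b : ℂ) (ha0 : a ≠ 0) (ha1 : a ≠ 1) (hb0 : b ≠ 0) (hb1 : b ≠ 1) (hba : b ≠ a)
    (hb : b^2 = a) :
    ∀ lam : ℂ, ∀ z : ℂ, z ≠ 0 → z ≠ 1 → z ≠ a → z ≠ b →
      ThirdOrderODE (Pcoef 0 0 0 a b) (Qcoef 0 0 0 0 a b lam)
        (fun t => (t - b)^2 * lam + (3 + 3*a - 4*b) * t^2 - 2*(5*b + 5*a*b - 8*a) * t
          + a*(3 + 3*a - 4*b)) z := by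
  intro lam z h0 h1 ha hzb
  subst hb
  have hΨ : (fun t : ℂ => (t - b)^2 * lam + (3 + 3*b^2 - 4*b) * t^2
      - 2*(5*b + 5*b^2*b - 8*b^2) * t + b^2*(3 + 3*b^2 - 4*b))
      = fun t => (lam + (3 + 3*b^2 - 4*b)) * t^2
        + (-2*b*lam - 2*(5*b + 5*b^2*b - 8*b^2)) * t
        + (b^2*lam + b^2*(3 + 3*b^2 - 4*b)) := by
    funext t
    ring
  have hz1 := sub_ne_zero.2 h1
  have hza := sub_ne_zero.2 ha
  have hzb' := sub_ne_zero.2 hzb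
  unfold ThirdOrderODE
  rw [hΨ, deriv_quadratic, deriv_linear, deriv_const,
    (hasDerivAt_Pcoef_zero h0 h1 ha hzb).deriv, (hasDerivAt_Qcoef_zero lam h0 h1 ha hzb).deriv]
  simp only [Pcoef, Qcoef, Nat.cast_zero]
  field_simp
  ring
end

section
/- Take characteristics (m₀, m₁, m₂, m₃) = (1,0,0,0) (so N = 3, N(N−2m₀−1) = 0, ρ = 3b² − 2(a+1)b + a) and assume 3b² − 2(a+1)b + a = 0 (so ρ = 0). Then for every λ ∈ ℂ the function Ψ(λ, z) = (z−b)²λ² + (z³ + 3(1+a−4b)z² − (7a − 8b − 8ab)z + (1/3)(5a² + 5a − 10a²b − 10b − 2ab))λ − (4/3)(a³ − 4a² + a − 2a³b + 3a²b + 3ab − 2b) satisfies the third-order equation Ψ''' + 3P·Ψ'' + (P' + 4Q + 2P²)·Ψ' + (2Q' + 4P·Q)·Ψ = 0 at every z ∈ ℂ ∖ {0, 1, a, b} (derivatives in z). -/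
/-- The derivative of `c / (t - w)` in `t`. -/
lemma hasDerivAt_const_div_sub (c w z : ℂ) (h : z - w ≠ 0) :
    HasDerivAt (fun t : ℂ => c / (t - w)) (-c / (z - w) ^ 2) z := by
  simpa using (hasDerivAt_const z c).fun_div ((hasDerivAt_id z).sub_const w) h

lemma deriv_Pcoef_zero (a b z : ℂ) (hz0 : z ≠ 0) (hz1 : z - 1 ≠ 0) (hza : z - a ≠ 0)
    (hzb : z - b ≠ 0) :
    deriv (Pcoef 0 0 0 a b) z =
      (1 / 2) * (-1 / z ^ 2 + -1 / (z - 1) ^ 2 + -1 / (z - a) ^ 2) - -2 / (z - b) ^ 2 := by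
  have h0 := hasDerivAt_const_div_sub 1 0 z (by simpa using hz0)
  simp only [sub_zero] at h0
  have h := ((((h0.fun_add (hasDerivAt_const_div_sub 1 1 z hz1)).fun_add
    (hasDerivAt_const_div_sub 1 a z hza)).const_mul (1 / 2)).fun_sub
    (hasDerivAt_const_div_sub 2 b z hzb)).deriv
  rw [← h]
  congr 1
  funext t
  simp [Pcoef]

/-- When `ρ = 0`, the coefficient `Q` with characteristics `(1, 0, 0, 0)` reduces to
`λ / (4 z (z - 1) (z - a))`. -/
lemma Qcoef_one_zero (a b lam : ℂ) (hb : 3 * b ^ 2 - 2 * (a + 1) * b + a = 0) :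
    Qcoef 1 0 0 0 a b lam = fun t => lam / (4 * t * (t - 1) * (t - a)) := by
  funext t
  have h : 2 * (2 * (b - 1) * (b - a) * ((0 : ℕ) : ℂ) + 2 * b * (b - a) * ((0 : ℕ) : ℂ)
      + 2 * b * (b - 1) * ((0 : ℕ) : ℂ) + 3 * b ^ 2 - 2 * (a + 1) * b + a) = 0 := by
    push_cast
    linear_combination 2 * hb
  unfold Qcoef
  rw [h]
  congr 1
  push_cast
  ring

lemma deriv_const_div_cubic (a lam z : ℂ) (hz0 : z ≠ 0) (hz1 : z - 1 ≠ 0) (hza : z - a ≠ 0) :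
    deriv (fun t => lam / (4 * t * (t - 1) * (t - a))) z =
      -(lam / (4 * z * (z - 1) * (z - a))) * (1 / z + 1 / (z - 1) + 1 / (z - a)) := by
  have h := ((((hasDerivAt_id z).const_mul 4).fun_mul ((hasDerivAt_id z).sub_const 1)).fun_mul
    ((hasDerivAt_id z).sub_const a))
  have hd := ((hasDerivAt_const z lam).fun_div h (by simp [hz0, hz1, hza])).deriv
  simp only [id] at hd
  rw [hd]
  field_simp
  ring

lemma deriv_cubic (c₃ c₂ c₁ c₀ : ℂ) :
    deriv (fun t : ℂ => c₃ * t ^ 3 + c₂ * t ^ 2 + c₁ * t + c₀) =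
      fun t => 0 * t ^ 3 + 3 * c₃ * t ^ 2 + 2 * c₂ * t + c₁ := by
  funext z
  have h := (((((hasDerivAt_pow 3 z).const_mul c₃).fun_add
    ((hasDerivAt_pow 2 z).const_mul c₂)).fun_add ((hasDerivAt_id z).const_mul c₁)).add_const c₀).deriv
  simp only [id] at h
  rw [h]
  push_cast
  ring

theorem fuchsian_psi_1000_quadratic (a b : ℂ) (ha0 : a ≠ 0) (ha1 : a ≠ 1) (hb0 : b ≠ 0) (hb1 : b ≠ 1) (hba : b ≠ a)
    (hb : 3*b^2 - 2*(a+1)*b + a = 0) :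
    ∀ lam : ℂ, ∀ z : ℂ, z ≠ 0 → z ≠ 1 → z ≠ a → z ≠ b →
      ThirdOrderODE (Pcoef 0 0 0 a b) (Qcoef 1 0 0 0 a b lam)
        (fun t => (t - b)^2 * lam^2
          + (t^3 + 3*(1 + a - 4*b) * t^2 - (7*a - 8*b - 8*a*b) * t
              + (1/3)*(5*a^2 + 5*a - 10*a^2*b - 10*b - 2*a*b)) * lam
          - (4/3)*(a^3 - 4*a^2 + a - 2*a^3*b + 3*a^2*b + 3*a*b - 2*b)) z := by
  intro lam z hz0 hz1 hza hzb
  replace hz1 := sub_ne_zero.mpr hz1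
  replace hza := sub_ne_zero.mpr hza
  replace hzb := sub_ne_zero.mpr hzb
  have hΨ : (fun t : ℂ => (t - b)^2 * lam^2
          + (t^3 + 3*(1 + a - 4*b) * t^2 - (7*a - 8*b - 8*a*b) * t
              + (1/3)*(5*a^2 + 5*a - 10*a^2*b - 10*b - 2*a*b)) * lam
          - (4/3)*(a^3 - 4*a^2 + a - 2*a^3*b + 3*a^2*b + 3*a*b - 2*b)) =
      fun t => lam * t ^ 3 + (lam ^ 2 + 3 * (1 + a - 4 * b) * lam) * t ^ 2
        + (-2 * b * lam ^ 2 - (7 * a - 8 * b - 8 * a * b) * lam) * t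
        + (b ^ 2 * lam ^ 2
          + (1 / 3) * (5 * a ^ 2 + 5 * a - 10 * a ^ 2 * b - 10 * b - 2 * a * b) * lam
          - (4 / 3) * (a ^ 3 - 4 * a ^ 2 + a - 2 * a ^ 3 * b + 3 * a ^ 2 * b + 3 * a * b
            - 2 * b)) := by
    funext t
    ring
  rw [ThirdOrderODE, hΨ, Qcoef_one_zero a b lam hb]
  simp only [deriv_cubic]
  rw [deriv_Pcoef_zero a b z hz0 hz1 hza hzb, deriv_const_div_cubic a lam z hz0 hz1 hza]
  simp only [Pcoef, Nat.cast_zero, mul_zero, sub_zero]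
  have hs : 2 * b - 1 ≠ 0 := by
    intro h
    have : (1 : ℂ) = 0 := by linear_combination -4 * hb + (6 * b - 4*a - 1) * h
    exact one_ne_zero this
  have ha : a = (3 * b ^ 2 - 2 * b) / (2 * b - 1) := by
    rw [eq_div_iff hs]
    linear_combination -hb
  field_simp
  clear ha0 ha1 hb0 hb1 hba hza hΨ hb hz0 hz1 hzb
  generalize hsb : 2 * b - 1 = s at hs ha
  obtain rfl : b = (s + 1) / 2 := by linear_combination hsb / 2
  clear hsb
  subst ha
  field_simp
  ring
end

section
/- Take characteristics (m₀, m₁, m₂, m₃) = (1,1,0,0) (so N = 4, N(N−2m₀−1) = 4, ρ = 2(b−1)(b−a) + 3b² − 2(a+1)b + a) and assume b² = a. Then for every λ ∈ ℂ the function Ψ(λ, z) = z(z−b)²λ + z⁴ + 8(1+a−2b)z³ + 2(19a − 10ab − 10b)z² + 8a(1+a−2b)z + a² satisfies the third-order equation Ψ''' + 3P·Ψ'' + (P' + 4Q + 2P²)·Ψ' + (2Q' + 4P·Q)·Ψ = 0 at every z ∈ ℂ ∖ {0, 1, a, b} (derivatives in z). -/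
theorem hasDerivAt_Pcoef (m₁ m₂ m₃ : ℕ) {a b z : ℂ} (h0 : z ≠ 0) (h1 : z ≠ 1) (ha : z ≠ a)
    (hb : z ≠ b) :
    HasDerivAt (Pcoef m₁ m₂ m₃ a b)
      ((1/2) * (-(1 - 2*(m₁:ℂ))/z^2 - (1 - 2*(m₂:ℂ))/(z-1)^2 - (1 - 2*(m₃:ℂ))/(z-a)^2)
        + 2/(z-b)^2) z := by
  have key (c e : ℂ) (h : z ≠ e) : HasDerivAt (fun t => c / (t - e)) (-c / (z - e)^2) z := by
    simpa using (hasDerivAt_const z c).fun_div ((hasDerivAt_id' z).sub_const e) (sub_ne_zero.2 h)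
  have h := ((((key (1 - 2*(m₁:ℂ)) 0 h0).fun_add (key (1 - 2*(m₂:ℂ)) 1 h1)).fun_add
    (key (1 - 2*(m₃:ℂ)) a ha)).const_mul (1/2)).fun_sub (key 2 b hb)
  simp only [sub_zero] at h
  refine h.congr_deriv ?_
  ring

theorem hasDerivAt_linear_add_pole_div_cubic (n lam r : ℂ) {a b z : ℂ} (h0 : z ≠ 0)
    (h1 : z ≠ 1) (ha : z ≠ a) (hb : z ≠ b) :
    HasDerivAt (fun t => (n * t + lam + r / (t - b)) / (4*t*(t-1)*(t-a)))
      ((n - r / (z - b)^2) / (4*z*(z-1)*(z-a))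
        - (n * z + lam + r / (z - b)) * ((z-1)*(z-a) + z*(z-a) + z*(z-1))
          / (4*z^2*(z-1)^2*(z-a)^2)) z := by
  have h1' := sub_ne_zero.2 h1
  have ha' := sub_ne_zero.2 ha
  have hb' := sub_ne_zero.2 hb
  have hid := hasDerivAt_id' z
  have h := (((hid.const_mul n).add_const lam).fun_add
    ((hasDerivAt_const z r).fun_div (hid.sub_const b) hb')).fun_div
    (((hid.const_mul 4).fun_mul (hid.sub_const 1)).fun_mul (hid.sub_const a))
    (by simp [h0, h1', ha'])
  refine h.congr_deriv ?_
  field_simp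
  ring

theorem deriv_quartic (c₀ c₁ c₂ c₃ c₄ : ℂ) :
    deriv (fun t => c₄ * t^4 + c₃ * t^3 + c₂ * t^2 + c₁ * t + c₀)
      = fun t => 0 * t^4 + 4 * c₄ * t^3 + 3 * c₃ * t^2 + 2 * c₂ * t + c₁ := by
  funext z
  have h := (((((hasDerivAt_pow 4 z).const_mul c₄).fun_add
    ((hasDerivAt_pow 3 z).const_mul c₃)).fun_add ((hasDerivAt_pow 2 z).const_mul c₂)).fun_add
    ((hasDerivAt_id' z).const_mul c₁)).add_const c₀
  rw [h.deriv]
  push_cast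
  ring

theorem fuchsian_psi_1100_b2_eq_a (a b : ℂ) (ha0 : a ≠ 0) (ha1 : a ≠ 1) (hb0 : b ≠ 0) (hb1 : b ≠ 1) (hba : b ≠ a)
    (hb : b^2 = a) :
    ∀ lam : ℂ, ∀ z : ℂ, z ≠ 0 → z ≠ 1 → z ≠ a → z ≠ b →
      ThirdOrderODE (Pcoef 1 0 0 a b) (Qcoef 1 1 0 0 a b lam)
        (fun t => t * (t - b)^2 * lam + t^4 + 8*(1 + a - 2*b) * t^3
          + 2*(19*a - 10*a*b - 10*b) * t^2 + 8*a*(1 + a - 2*b) * t + a^2) z := by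
  subst hb
  intro lam z h0 h1 ha hzb
  have h1' := sub_ne_zero.2 h1
  have ha' := sub_ne_zero.2 ha
  have hb' := sub_ne_zero.2 hzb
  have hQ : Qcoef 1 1 0 0 (b^2) b lam = fun t =>
      (4 * t + lam + (-8 * b * (b - 1)^2) / (t - b)) / (4*t*(t-1)*(t-b^2)) := by
    funext t
    simp only [Qcoef, Nat.cast_one, Nat.cast_zero]
    ring
  have hΨ : (fun t : ℂ => t * (t - b)^2 * lam + t^4 + 8*(1 + b^2 - 2*b) * t^3
      + 2*(19*b^2 - 10*b^2*b - 10*b) * t^2 + 8*b^2*(1 + b^2 - 2*b) * t + (b^2)^2)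
      = fun t => 1 * t^4 + (8*(b-1)^2 + lam) * t^3
        + (2*(19*b^2 - 10*b^3 - 10*b) - 2*b*lam) * t^2
        + (8*b^2*(b-1)^2 + b^2*lam) * t + b^4 := by
    funext t
    ring
  rw [ThirdOrderODE, (hasDerivAt_Pcoef 1 0 0 h0 h1 ha hzb).deriv, hQ,
    (hasDerivAt_linear_add_pole_div_cubic _ _ _ h0 h1 ha hzb).deriv, hΨ]
  simp only [deriv_quartic, Pcoef, Nat.cast_one, Nat.cast_zero]
  field_simp
  ring
end

section
/- Take characteristics (m₀, m₁, m₂, m₃) = (0,0,0,0) (so N = 2, ρ = 3b² − 2(a+1)b + a) and assume b² = a, and let Ψ(λ, z) = (z−b)²λ + (3+3a−4b)z² − 2(5b+5ab−8a)z + a(3+3a−4b). Then for every λ ∈ ℂ and every z ∈ ℂ ∖ {0, 1, a, b} the identity (2Ψ·Ψ_zz − (Ψ_z)² + 2P·Ψ·Ψ_z + 4Q·Ψ²)·z(z−1)(z−a) = (z−b)⁴·(λ − 4b + 3a + 3)(λ² + 7(1+a−2b)λ + 2(6a² + 36a + 6 − 25ab − 25b)) holds; i.e., the spectral curve of this finite-gap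 Fuchsian equation is ν² = (λ − 4b + 3a + 3)(λ² + 7(1+a−2b)λ + 2(6a² + 36a + 6 − 25ab − 25b)). -/
/-- The combination `2Ψ·Ψ_zz − (Ψ_z)² + 2P·Ψ·Ψ_z + 4Q·Ψ²` whose value determines the
hyperelliptic spectral curve `ν² = ν²(λ)` of the finite-gap Fuchsian equation. -/
noncomputable def nuSqExpr (P Q Ψ : ℂ → ℂ) (z : ℂ) : ℂ :=
  2 * Ψ z * deriv (deriv Ψ) z - (deriv Ψ z)^2
    + 2 * P z * Ψ z * deriv Ψ z + 4 * Q z * (Ψ z)^2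

/-- For a quadratic polynomial `Ψ`, the combination `nuSqExpr` is computed by the formal derivatives. -/
theorem nuSqExpr_quadratic (P Q : ℂ → ℂ) (A B C z : ℂ) :
    nuSqExpr P Q (fun t => A * t^2 + B * t + C) z
      = 2 * (A * z^2 + B * z + C) * (2 * A) - (2 * A * z + B)^2
        + 2 * P z * (A * z^2 + B * z + C) * (2 * A * z + B)
        + 4 * Q z * (A * z^2 + B * z + C)^2 := by
  have h₁ : deriv (fun t : ℂ => A * t^2 + B * t + C) = fun t => 2 * A * t + B := by
    funext t
    have h := (((hasDerivAt_pow 2 t).const_mul A).add ((hasDerivAt_id t).const_mul B)).add_const C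
    refine (h.congr_deriv ?_).deriv
    push_cast
    ring
  have h₂ : deriv (fun t : ℂ => 2 * A * t + B) z = 2 * A := by
    have h := ((hasDerivAt_id z).const_mul (2 * A)).add_const B
    exact (h.congr_deriv (mul_one _)).deriv
  simp only [nuSqExpr, h₁, h₂]

theorem spectral_curve_0000_b2_eq_a (a b : ℂ) (ha0 : a ≠ 0) (ha1 : a ≠ 1) (hb0 : b ≠ 0) (hb1 : b ≠ 1) (hba : b ≠ a)
    (hb : b^2 = a) :
    ∀ lam : ℂ, ∀ z : ℂ, z ≠ 0 → z ≠ 1 → z ≠ a → z ≠ b →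
      nuSqExpr (Pcoef 0 0 0 a b) (Qcoef 0 0 0 0 a b lam)
        (fun t => (t - b)^2 * lam + (3 + 3*a - 4*b) * t^2 - 2*(5*b + 5*a*b - 8*a) * t
          + a*(3 + 3*a - 4*b)) z * (z*(z-1)*(z-a))
      = (z - b)^4 *
        ((lam - 4*b + 3*a + 3)
          * (lam^2 + 7*(1 + a - 2*b) * lam + 2*(6*a^2 + 36*a + 6 - 25*a*b - 25*b))) := by
  intro lam z hz0 hz1 hza hzb
  have hΨ : (fun t : ℂ => (t - b)^2 * lam + (3 + 3*a - 4*b) * t^2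
        - 2*(5*b + 5*a*b - 8*a) * t + a*(3 + 3*a - 4*b))
      = fun t => (lam + (3 + 3*a - 4*b)) * t^2 + (-2*b*lam - 2*(5*b + 5*a*b - 8*a)) * t
        + (b^2*lam + a*(3 + 3*a - 4*b)) := by
    funext t
    ring
  rw [hΨ, nuSqExpr_quadratic]
  subst hb
  have hz1' : z - 1 ≠ 0 := sub_ne_zero.mpr hz1
  have hza' : z - b^2 ≠ 0 := sub_ne_zero.mpr hza
  have hzb' : z - b ≠ 0 := sub_ne_zero.mpr hzb
  simp only [Pcoef, Qcoef, Nat.cast_zero]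
  field_simp
  ring
end

section
/- Take characteristics (m₀, m₁, m₂, m₃) = (1,0,0,0) (so N = 3, N(N−2m₀−1) = 0, ρ = 3b² − 2(a+1)b + a) and assume 3b² − 2(a+1)b + a = 0, and let Ψ(λ, z) = (z−b)²λ² + (z³ + 3(1+a−4b)z² − (7a − 8b − 8ab)z + (1/3)(5a² + 5a − 10a²b − 10b − 2ab))λ − (4/3)(a³ − 4a² + a − 2a³b + 3a²b + 3ab − 2b). Then for every λ ∈ ℂ and every z ∈ ℂ ∖ {0, 1, a, b} the identity (2Ψ·Ψ_zz − (Ψ_z)² + 2P·Ψ·Ψ_z + 4Q·Ψ²)·z(z−1)(z−a) = (z−b)⁴·λ(λ⁴ + 10(a+1−3b)λ³ + 33(a² − a + 1)λ² + 3(12a³ + a² + a + 12 − 38a²b + 38ab − 38b)λ − 12(a³ − 4a² + a − 2a³b + 3a²b + 3ab − 2b)) holds; i.e., the spectral curve is ν² = λ(λ⁴ + 10(a+1−3b)λ³ + 33(a²−a+1)λ² + 3(12a³+a²+a+12−38a²b+38ab−38b)λ − 12(a³−4a²+a−2a³b+3a²b+3ab−2b)). -/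
/-- Derivative of the cubic-in-`t` polynomial `(t - b)² λ² + (t³ + c₂ t² - c₁ t + c₀) λ - k`. -/
theorem hasDerivAt_psi (b lam c₂ c₁ c₀ k t : ℂ) :
    HasDerivAt (fun t : ℂ => (t - b)^2 * lam^2 + (t^3 + c₂ * t^2 - c₁ * t + c₀) * lam - k)
      (2 * (t - b) * lam^2 + (3 * t^2 + 2 * c₂ * t - c₁) * lam) t := by
  have h := ((((((hasDerivAt_id t).sub_const b).pow 2).mul_const (lam^2)).add
    ((((((hasDerivAt_id t).pow 3).add (((hasDerivAt_id t).pow 2).const_mul c₂)).sub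
      ((hasDerivAt_id t).const_mul c₁)).add_const c₀).mul_const lam)).sub_const k)
  refine h.congr_deriv ?_
  simp only [id, Nat.reduceSub, Nat.cast_ofNat]
  ring

/-- Second derivative of the same polynomial. -/
theorem hasDerivAt_deriv_psi (b lam c₂ c₁ t : ℂ) :
    HasDerivAt (fun t : ℂ => 2 * (t - b) * lam^2 + (3 * t^2 + 2 * c₂ * t - c₁) * lam)
      (2 * lam^2 + (6 * t + 2 * c₂) * lam) t := by
  have h := (((((hasDerivAt_id t).sub_const b).const_mul 2).mul_const (lam^2)).add
    ((((((hasDerivAt_id t).pow 2).const_mul 3).add ((hasDerivAt_id t).const_mul (2 * c₂))).sub_const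
      c₁).mul_const lam))
  refine h.congr_deriv ?_
  simp only [id, Nat.reduceSub, Nat.cast_ofNat]
  ring

/-- With characteristics `(1, 0, 0, 0)` and `ρ = 0`, the combination `nuSqExpr` of the polynomial
`Ψ`, cleared of its poles at `0`, `1` and `a`. -/
theorem fuchsian_psi_nuSqExpr (a b lam z c₂ c₁ c₀ k : ℂ)
    (hz0 : z ≠ 0) (hz1 : z ≠ 1) (hza : z ≠ a) (hzb : z ≠ b)
    (hb : 3*b^2 - 2*(a+1)*b + a = 0) :
    nuSqExpr (Pcoef 0 0 0 a b) (Qcoef 1 0 0 0 a b lam)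
      (fun t => (t - b)^2 * lam^2 + (t^3 + c₂ * t^2 - c₁ * t + c₀) * lam - k) z * (z*(z-1)*(z-a))
    = (((2 * ((z - b)^2 * lam^2 + (z^3 + c₂ * z^2 - c₁ * z + c₀) * lam - k)
            * (2 * lam^2 + (6 * z + 2 * c₂) * lam)
          - (2 * (z - b) * lam^2 + (3 * z^2 + 2 * c₂ * z - c₁) * lam)^2) * (z*(z-1)*(z-a))
        + ((z-1)*(z-a) + z*(z-a) + z*(z-1))
          * ((z - b)^2 * lam^2 + (z^3 + c₂ * z^2 - c₁ * z + c₀) * lam - k)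
          * (2 * (z - b) * lam^2 + (3 * z^2 + 2 * c₂ * z - c₁) * lam)
        + lam * ((z - b)^2 * lam^2 + (z^3 + c₂ * z^2 - c₁ * z + c₀) * lam - k)^2) * (z - b)
      - 4 * (z*(z-1)*(z-a)) * ((z - b)^2 * lam^2 + (z^3 + c₂ * z^2 - c₁ * z + c₀) * lam - k)
          * (2 * (z - b) * lam^2 + (3 * z^2 + 2 * c₂ * z - c₁) * lam)) / (z - b) := by
  have h1 : deriv (fun t : ℂ => (t - b)^2 * lam^2 + (t^3 + c₂ * t^2 - c₁ * t + c₀) * lam - k)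
      = fun t => 2 * (t - b) * lam^2 + (3 * t^2 + 2 * c₂ * t - c₁) * lam :=
    funext fun t => (hasDerivAt_psi b lam c₂ c₁ c₀ k t).deriv
  have hQ : Qcoef 1 0 0 0 a b lam z = lam / (4*z*(z-1)*(z-a)) := by
    have hρ : 2 * (2*(b-1)*(b-a)*((0:ℕ):ℂ) + 2*b*(b-a)*((0:ℕ):ℂ) + 2*b*(b-1)*((0:ℕ):ℂ)
        + 3*b^2 - 2*(a+1)*b + a) = 0 := by
      push_cast
      linear_combination 2 * hb
    rw [Qcoef, hρ]
    congr 1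
    push_cast
    ring
  have hz1' : z - 1 ≠ 0 := sub_ne_zero.mpr hz1
  have hza' : z - a ≠ 0 := sub_ne_zero.mpr hza
  have hzb' : z - b ≠ 0 := sub_ne_zero.mpr hzb
  simp only [nuSqExpr, h1, (hasDerivAt_deriv_psi b lam c₂ c₁ z).deriv, hQ, Pcoef]
  generalize (z - b)^2 * lam^2 + (z^3 + c₂ * z^2 - c₁ * z + c₀) * lam - k = Y
  generalize 2 * (z - b) * lam^2 + (3 * z^2 + 2 * c₂ * z - c₁) * lam = Y'
  push_cast
  field_simp
  ring

theorem spectral_curve_1000_quadratic (a b : ℂ) (ha0 : a ≠ 0) (ha1 : a ≠ 1) (hb0 : b ≠ 0) (hb1 : b ≠ 1) (hba : b ≠ a)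
    (hb : 3*b^2 - 2*(a+1)*b + a = 0) :
    ∀ lam : ℂ, ∀ z : ℂ, z ≠ 0 → z ≠ 1 → z ≠ a → z ≠ b →
      nuSqExpr (Pcoef 0 0 0 a b) (Qcoef 1 0 0 0 a b lam)
        (fun t => (t - b)^2 * lam^2
          + (t^3 + 3*(1 + a - 4*b) * t^2 - (7*a - 8*b - 8*a*b) * t
              + (1/3)*(5*a^2 + 5*a - 10*a^2*b - 10*b - 2*a*b)) * lam
          - (4/3)*(a^3 - 4*a^2 + a - 2*a^3*b + 3*a^2*b + 3*a*b - 2*b)) z * (z*(z-1)*(z-a))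
      = (z - b)^4 *
        (lam * (lam^4 + 10*(a + 1 - 3*b) * lam^3 + 33*(a^2 - a + 1) * lam^2
          + 3*(12*a^3 + a^2 + a + 12 - 38*a^2*b + 38*a*b - 38*b) * lam
          - 12*(a^3 - 4*a^2 + a - 2*a^3*b + 3*a^2*b + 3*a*b - 2*b))) := by
  intro lam z hz0 hz1 hza hzb
  rw [fuchsian_psi_nuSqExpr a b lam z _ _ _ _ hz0 hz1 hza hzb hb]
  have hd : 2 * b - 1 ≠ 0 := by
    intro h
    have : (1 : ℂ) = 0 := by linear_combination (-4) * hb + (6 * b - 1 - 4 * a) * h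
    exact one_ne_zero this
  obtain rfl : a = (3 * b ^ 2 - 2 * b) / (2 * b - 1) := by
    rw [eq_div_iff hd]
    linear_combination -hb
  have hzb' : z - b ≠ 0 := sub_ne_zero.mpr hzb
  rw [div_eq_iff hzb']
  field_simp
  ring
end

section
/- Take characteristics (m₀, m₁, m₂, m₃) = (1,0,0,0) (so N = 3, N(N−2m₀−1) = 0, ρ = 3b² − 2(a+1)b + a) and assume 3b⁴ − 4(a+1)b³ + 6ab² − a² = 0, and let Ψ(λ, z) = (z−b)²λ + z³ + 3(1+a−4b)z² + (2a − 10ab − 10b + 27b²)z + 2ab + 3ab² + 3b² − 12b³. Then for every λ ∈ ℂ and every z ∈ ℂ ∖ {0, 1, a, b} the identity (2Ψ·Ψ_zz − (Ψ_z)² + 2P·Ψ·Ψ_z + 4Q·Ψ²)·z(z−1)(z−a) = (z−b)⁴·(λ³ + 10(1+a−3b)λ² + 3(11a² + 19a + 90b² − 60ab − 60b + 11)λ + 36a³ + 73a² + 73a + 36 − 254b − 376ab − 254a²b + 630b² + 630ab² − 630b³) holds; i.e., the spectral curve is ν² = λ³ + 10(1+a−3b)λ² + 3(11a²+19a+90b²−60ab−60b+11)λ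 + 36a³+73a²+73a+36−254b−376ab−254a²b+630b²+630ab²−630b³. -/
/-- The derivative of a cubic polynomial function written as a quadratic in `t - b` plus a cubic. -/
lemma hasDerivAt_quadratic_add_cubic (b l p q r s u t : ℂ) :
    HasDerivAt (fun t : ℂ => (t - b)^2 * l + t^3 + p * t^2 + q * t + r + s + u - 12*b^3)
      (2 * (t - b) * l + 3 * t^2 + 2 * p * t + q) t := by
  have h := ((((((((((hasDerivAt_id t).sub_const b).pow 2).mul_const l).add
    ((hasDerivAt_id t).pow 3)).add (((hasDerivAt_id t).pow 2).const_mul p)).add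
    ((hasDerivAt_id t).const_mul q)).add_const r).add_const s).add_const u).sub_const (12*b^3)
  refine h.congr_deriv ?_
  simp
  ring

/-- The derivative of `hasDerivAt_quadratic_add_cubic`, differentiated once more. -/
lemma hasDerivAt_linear_add_quadratic (b l p q t : ℂ) :
    HasDerivAt (fun t : ℂ => 2 * (t - b) * l + 3 * t^2 + 2 * p * t + q)
      (2 * l + 6 * t + 2 * p) t := by
  have h := ((((((hasDerivAt_id t).sub_const b).const_mul 2).mul_const l).add
    (((hasDerivAt_id t).pow 2).const_mul 3)).add ((hasDerivAt_id t).const_mul (2*p))).add_const q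
  refine h.congr_deriv ?_
  simp
  ring


theorem spectral_curve_1000_quartic (a b : ℂ) (ha0 : a ≠ 0) (ha1 : a ≠ 1) (hb0 : b ≠ 0) (hb1 : b ≠ 1) (hba : b ≠ a)
    (hb : 3*b^4 - 4*(a+1)*b^3 + 6*a*b^2 - a^2 = 0) :
    ∀ lam : ℂ, ∀ z : ℂ, z ≠ 0 → z ≠ 1 → z ≠ a → z ≠ b →
      nuSqExpr (Pcoef 0 0 0 a b) (Qcoef 1 0 0 0 a b lam)
        (fun t => (t - b)^2 * lam + t^3 + 3*(1 + a - 4*b) * t^2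
          + (2*a - 10*a*b - 10*b + 27*b^2) * t + 2*a*b + 3*a*b^2 + 3*b^2 - 12*b^3) z * (z*(z-1)*(z-a))
      = (z - b)^4 *
        (lam^3 + 10*(1 + a - 3*b) * lam^2
          + 3*(11*a^2 + 19*a + 90*b^2 - 60*a*b - 60*b + 11) * lam
          + 36*a^3 + 73*a^2 + 73*a + 36 - 254*b - 376*a*b - 254*a^2*b
          + 630*b^2 + 630*a*b^2 - 630*b^3) := by
  intro lam z hz0 hz1 hza hzb
  have hz1' : z - 1 ≠ 0 := sub_ne_zero.mpr hz1
  have hza' : z - a ≠ 0 := sub_ne_zero.mpr hza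
  have hzb' : z - b ≠ 0 := sub_ne_zero.mpr hzb
  have hP : Pcoef 0 0 0 a b z * (2 * (z*(z-1)*(z-a)) * (z-b))
      = (z-1)*(z-a)*(z-b) + z*(z-a)*(z-b) + z*(z-1)*(z-b) - 4*(z*(z-1)*(z-a)) := by
    simp only [Pcoef, Nat.cast_zero]
    field_simp
    ring
  have hQ : Qcoef 1 0 0 0 a b lam z * (4 * (z*(z-1)*(z-a)) * (z-b))
      = lam*(z-b) + 2*(3*b^2 - 2*(a+1)*b + a) := by
    simp only [Qcoef, Nat.cast_zero, Nat.cast_one]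
    field_simp
    ring
  have hΨ := fun t => (hasDerivAt_quadratic_add_cubic b lam (3*(1 + a - 4*b))
    (2*a - 10*a*b - 10*b + 27*b^2) (2*a*b) (3*a*b^2) (3*b^2) t).deriv
  have hΨ' := (hasDerivAt_linear_add_quadratic b lam (3*(1 + a - 4*b))
    (2*a - 10*a*b - 10*b + 27*b^2) z).deriv
  rw [nuSqExpr, funext hΨ, hΨ']
  refine mul_right_cancel₀ hzb' ?_
  generalize Pcoef 0 0 0 a b z = P at hP ⊢
  generalize Qcoef 1 0 0 0 a b lam z = Q at hQ ⊢
  beta_reduce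
  linear_combination
    ((z - b)^2 * lam + z^3 + 3*(1 + a - 4*b) * z^2
      + (2*a - 10*a*b - 10*b + 27*b^2) * z + 2*a*b + 3*a*b^2 + 3*b^2 - 12*b^3)
      * (2 * (z - b) * lam + 3 * z^2 + 2 * (3*(1 + a - 4*b)) * z
        + (2*a - 10*a*b - 10*b + 27*b^2)) * hP
    + ((z - b)^2 * lam + z^3 + 3*(1 + a - 4*b) * z^2
      + (2*a - 10*a*b - 10*b + 27*b^2) * z + 2*a*b + 3*a*b^2 + 3*b^2 - 12*b^3)^2 * hQ
    + (6*(z - b)^3*lam + 12*z^4 + 18*a*z^3 + 18*z^3 - 102*b*z^3 + 8*a*z^2 - 70*a*b*z^2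
      - 70*b*z^2 + 258*b^2*z^2 + 74*a*b^2*z - 4*a*b*z + 74*b^2*z - 246*b^3*z
      - 22*a*b^3 - 4*a*b^2 - 22*b^3 + 78*b^4) * hb
end
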